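/- Johnson–Lindenstrauss lemma: let S ⊂ ℝ^d be a finite set of n points and λ ∈ (0, 1). If k ≥ 20·ln(n)/λ², then there exists a linear map f : ℝ^d → ℝ^k such that for all x, y ∈ S, (1−λ)‖x−y‖₂² ≤ ‖f(x)−f(y)‖₂² ≤ (1+λ)‖x−y‖₂². -/

import Mathlib

open MeasureTheory ProbabilityTheory

namespace JohnsonLindenstrauss

lemma one_add_le_exp_sub_sq_div_four {δ : ℝ} (h₁ : -1 ≤ δ) (h₂ : δ ≤ 1) :
    1 + δ ≤ Real.exp (δ - δ ^ 2 / 4) := by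
  rcases le_total 0 δ with h | h
  · have hy : 0 ≤ δ - δ ^ 2 / 4 := by nlinarith
    refine le_trans ?_ (Real.quadratic_le_exp_of_nonneg hy)
    have : 0 ≤ δ ^ 2 * (1 - δ) := mul_nonneg (sq_nonneg _) (by linarith)
    nlinarith [sq_nonneg (δ ^ 2)]
  · have hexp : Real.exp (δ - δ ^ 2 / 4) = Real.exp ((δ - δ ^ 2 / 4) / 2) ^ 2 := by
      rw [← Real.exp_nat_mul]; congr 1; push_cast; ring
    have hy : 0 ≤ (δ - δ ^ 2 / 4) / 2 + 1 := by nlinarith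
    rw [hexp]
    refine le_trans ?_ (pow_le_pow_left₀ hy (Real.add_one_le_exp _) 2)
    have : 0 ≤ δ ^ 2 * (-δ) := mul_nonneg (sq_nonneg _) (by linarith)
    nlinarith [sq_nonneg (δ ^ 2)]

/-- The moment generating function of a chi-squared variable with one degree of freedom. -/
lemma integral_exp_mul_sq_gaussianReal {s : ℝ} (hs : s < 1 / 2) :
    ∫ x, Real.exp (s * x ^ 2) ∂(gaussianReal 0 1) = √((1 - 2 * s)⁻¹) := by
  rw [integral_gaussianReal_eq_integral_smul one_ne_zero]
  have h : ∀ x : ℝ, gaussianPDFReal 0 1 x • Real.exp (s * x ^ 2) =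
      (√(2 * Real.pi))⁻¹ * Real.exp (-(1 / 2 - s) * x ^ 2) := fun x => by
    rw [gaussianPDFReal, smul_eq_mul, mul_assoc, ← Real.exp_add]
    simp only [NNReal.coe_one, mul_one, sub_zero]
    congr 2
    ring
  simp_rw [h]
  rw [integral_const_mul, integral_gaussian, ← Real.sqrt_inv, ← Real.sqrt_mul (by positivity)]
  have h₁ : (1 / 2 - s) ≠ 0 := by linarith
  have h₂ : (1 - 2 * s) ≠ 0 := by linarith
  congr 1
  field_simp

lemma card_mul_exp_lt_one {n : ℕ} (hn : 2 ≤ n) :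
    ((n * n - n : ℕ) : ℝ) * (2 * Real.exp (-(5 / 2 * Real.log n))) < 1 := by
  have hn0 : (0 : ℝ) < n := by positivity
  set m : ℝ := √n with hm
  have hm0 : 0 < m := Real.sqrt_pos.2 hn0
  have hmn : (n : ℝ) = m ^ 2 := (Real.sq_sqrt hn0.le).symm
  have hexp : Real.exp (-(5 / 2 * Real.log n)) = (m ^ 5)⁻¹ := by
    rw [Real.exp_neg, hmn, Real.log_pow, ← Real.exp_log (pow_pos hm0 5), Real.log_pow]
    congr 2
    push_cast
    ring
  rw [hexp, Nat.cast_sub (Nat.le_mul_self n), Nat.cast_mul, hmn, ← mul_assoc,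
    ← div_eq_mul_inv, div_lt_one (pow_pos hm0 5)]
  have key : 0 < m ^ 3 - 2 * m ^ 2 + 2 := by
    nlinarith [mul_nonneg hm0.le (sq_nonneg (m - 4 / 3)), sq_nonneg (m - 4 / 3)]
  nlinarith [mul_pos (pow_pos hm0 2) key]

variable {E : Type*} [NormedAddCommGroup E] [InnerProductSpace ℝ E]

/-- The linear map `x ↦ (⟪x, R j⟫ / √k)_j`. -/
noncomputable def projection {k : ℕ} (R : Fin k → E) : E →ₗ[ℝ] EuclideanSpace ℝ (Fin k) :=
  (√k)⁻¹ • ((WithLp.linearEquiv 2 ℝ (Fin k → ℝ)).symm.toLinearMap ∘ₗ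
    LinearMap.pi fun j => (innerSL ℝ (R j)).toLinearMap)

lemma norm_projection_sq {k : ℕ} (R : Fin k → E) (v : E) :
    ‖projection R v‖ ^ 2 = (∑ j, inner ℝ v (R j) ^ 2) / k := by
  rw [projection, LinearMap.smul_apply, norm_smul, mul_pow, EuclideanSpace.real_norm_sq_eq,
    Real.norm_eq_abs, sq_abs, inv_pow, Real.sq_sqrt (Nat.cast_nonneg k), div_eq_inv_mul]
  simp [real_inner_comm]

/-- The Chernoff weight of the event that `∑ j, ⟪u, R j⟫ ^ 2` is beyond `(1 + δ) * k`. -/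
noncomputable def chernoffWeight {k : ℕ} (δ : ℝ) (u : E) (R : Fin k → E) : ℝ :=
  Real.exp (δ / (2 * (1 + δ)) * (∑ j, inner ℝ u (R j) ^ 2 - (1 + δ) * k))

variable [FiniteDimensional ℝ E] [MeasurableSpace E] [BorelSpace E]

lemma stdGaussian_map_inner {u : E} (hu : ‖u‖ = 1) :
    (stdGaussian E).map (fun r => inner ℝ u r) = gaussianReal 0 1 := by
  have h := IsGaussian.map_eq_gaussianReal (μ := stdGaussian E) (innerSL ℝ u)
  rw [integral_strongDual_stdGaussian, variance_dual_stdGaussian, innerSL_apply_norm, hu] at h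
  simpa using h

lemma integral_chernoffWeight {k : ℕ} {δ : ℝ} (hδ : -1 < δ) {u : E} (hu : ‖u‖ = 1) :
    ∫ R, chernoffWeight (k := k) δ u R ∂(Measure.pi fun _ => stdGaussian E) =
      Real.exp (-(δ * k / 2)) * √(1 + δ) ^ k := by
  have hpos : 0 < 1 + δ := by linarith
  have hsplit : ∀ R : Fin k → E, chernoffWeight δ u R =
      Real.exp (-(δ * k / 2)) * ∏ j, Real.exp (δ / (2 * (1 + δ)) * inner ℝ u (R j) ^ 2) := by
    intro R
    rw [chernoffWeight, ← Real.exp_sum, ← Real.exp_add, ← Finset.mul_sum]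
    congr 1
    field_simp
    ring
  have hone : ∫ r, Real.exp (δ / (2 * (1 + δ)) * inner ℝ u r ^ 2) ∂(stdGaussian E) =
      √(1 + δ) := by
    have hmap := integral_map (μ := stdGaussian E) (φ := fun r => inner ℝ u r)
      (f := fun x : ℝ => Real.exp (δ / (2 * (1 + δ)) * x ^ 2))
      (by fun_prop) (Continuous.aestronglyMeasurable (by fun_prop))
    rw [← hmap, stdGaussian_map_inner hu, integral_exp_mul_sq_gaussianReal]
    · congr 1
      field_simp
      ring
    · rw [div_lt_div_iff₀ (by positivity) (by norm_num)]
      linarith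
  simp_rw [hsplit]
  rw [integral_const_mul,
    integral_fintype_prod_eq_prod (f := fun (_ : Fin k) r =>
      Real.exp (δ / (2 * (1 + δ)) * inner ℝ u r ^ 2))]
  simp [hone]

lemma integrable_chernoffWeight {k : ℕ} {δ : ℝ} (hδ : -1 < δ) {u : E} (hu : ‖u‖ = 1) :
    Integrable (chernoffWeight (k := k) δ u) (Measure.pi fun _ => stdGaussian E) := by
  have hpos : 0 < 1 + δ := by linarith
  apply Integrable.of_integral_ne_zero
  rw [integral_chernoffWeight hδ hu]
  positivity

lemma integral_chernoffWeight_le {k : ℕ} {δ : ℝ} (hδ : -1 < δ) (hδ' : δ ≤ 1) {u : E}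
    (hu : ‖u‖ = 1) :
    ∫ R, chernoffWeight (k := k) δ u R ∂(Measure.pi fun _ => stdGaussian E) ≤
      Real.exp (-(k * δ ^ 2 / 8)) := by
  rw [integral_chernoffWeight hδ hu]
  have hsqrt : √(1 + δ) ≤ Real.exp ((δ - δ ^ 2 / 4) / 2) := by
    rw [Real.exp_half]
    exact Real.sqrt_le_sqrt (one_add_le_exp_sub_sq_div_four hδ.le hδ')
  calc Real.exp (-(δ * k / 2)) * √(1 + δ) ^ k
      ≤ Real.exp (-(δ * k / 2)) * Real.exp ((δ - δ ^ 2 / 4) / 2) ^ k := by gcongr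
    _ = Real.exp (-(k * δ ^ 2 / 8)) := by
      rw [← Real.exp_nat_mul, ← Real.exp_add]
      congr 1
      ring

/-- If the expected total Chernoff weight of a finite family of unit vectors is below `1`, some
`R` satisfies all the two-sided estimates at once. -/
lemma exists_forall_sum_inner_sq {k : ℕ} {ι : Type*} (T : Finset ι) (u : ι → E)
    (hu : ∀ i ∈ T, ‖u i‖ = 1) {lam : ℝ} (hlam : 0 < lam) (hlam1 : lam < 1)
    (hT : T.card * (2 * Real.exp (-(k * lam ^ 2 / 8))) < 1) :
    ∃ R : Fin k → E, ∀ i ∈ T, (1 - lam) * k ≤ ∑ j, inner ℝ (u i) (R j) ^ 2 ∧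
      ∑ j, inner ℝ (u i) (R j) ^ 2 ≤ (1 + lam) * k := by
  let μ : Measure (Fin k → E) := Measure.pi fun _ => stdGaussian E
  let F : (Fin k → E) → ℝ := fun R =>
    ∑ i ∈ T, (chernoffWeight lam (u i) R + chernoffWeight (-lam) (u i) R)
  have hterm : ∀ i ∈ T, Integrable
      (fun R => chernoffWeight lam (u i) R + chernoffWeight (-lam) (u i) R) μ := fun i hi =>
    (integrable_chernoffWeight (by linarith) (hu i hi)).add
      (integrable_chernoffWeight (by linarith) (hu i hi))
  have hF : Integrable F μ := integrable_finsetSum _ hterm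
  have hlt : ∫ R, F R ∂μ < 1 := by
    refine lt_of_le_of_lt ?_ hT
    rw [integral_finsetSum _ hterm, ← nsmul_eq_mul]
    refine Finset.sum_le_card_nsmul _ _ _ fun i hi => ?_
    rw [integral_add (integrable_chernoffWeight (by linarith) (hu i hi))
      (integrable_chernoffWeight (by linarith) (hu i hi)), two_mul]
    have h₁ := integral_chernoffWeight_le (k := k) (δ := lam) (by linarith) hlam1.le (hu i hi)
    have h₂ := integral_chernoffWeight_le (k := k) (δ := -lam) (by linarith) (by linarith) (hu i hi)
    rw [neg_sq] at h₂
    exact add_le_add h₁ h₂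
  obtain ⟨R, hR⟩ := exists_le_integral hF
  refine ⟨R, fun i hi => ?_⟩
  have hpos : ∀ (δ : ℝ) (v : E), 0 < chernoffWeight δ v R := fun _ _ => Real.exp_pos _
  have hi1 : chernoffWeight lam (u i) R + chernoffWeight (-lam) (u i) R < 1 :=
    (Finset.single_le_sum (f := fun i => chernoffWeight lam (u i) R + chernoffWeight (-lam) (u i) R)
      (fun i _ => (add_pos (hpos _ _) (hpos _ _)).le) hi).trans_lt (hR.trans_lt hlt)
  have hup : chernoffWeight lam (u i) R < 1 := by linarith [hpos (-lam) (u i)]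
  have hlow : chernoffWeight (-lam) (u i) R < 1 := by linarith [hpos lam (u i)]
  rw [chernoffWeight, Real.exp_lt_one_iff] at hup hlow
  constructor
  · have hs : -lam / (2 * (1 + -lam)) < 0 := div_neg_of_neg_of_pos (by linarith) (by linarith)
    have := pos_of_mul_neg_right hlow hs.le
    linarith
  · have hs : 0 < lam / (2 * (1 + lam)) := by positivity
    have := neg_of_mul_neg_right hup hs.le
    linarith

end JohnsonLindenstrauss

open JohnsonLindenstrauss


/-- Johnson–Lindenstrauss lemma: for a finite set `S ⊂ ℝ^d` of `n ≥ 2` points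
and `λ ∈ (0,1)`, if `k ≥ 20·ln(n)/λ²` then there is a linear map
`f : ℝ^d → ℝ^k` distorting all pairwise squared distances by at most `1 ± λ`. -/
theorem johnson_lindenstrauss {d k : ℕ} (n : ℕ) (hn : 2 ≤ n)
    (S : Finset (EuclideanSpace ℝ (Fin d))) (hS : S.card = n)
    (lam : ℝ) (hlam : 0 < lam) (hlam1 : lam < 1)
    (hk : 20 * Real.log n / lam ^ 2 ≤ k) :
    ∃ f : EuclideanSpace ℝ (Fin d) →ₗ[ℝ] EuclideanSpace ℝ (Fin k),
      ∀ x ∈ S, ∀ y ∈ S,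
        (1 - lam) * ‖x - y‖ ^ 2 ≤ ‖f x - f y‖ ^ 2 ∧
        ‖f x - f y‖ ^ 2 ≤ (1 + lam) * ‖x - y‖ ^ 2 := by
  have hlogn : 0 < Real.log n := Real.log_pos (by exact_mod_cast hn)
  have hk0 : (0 : ℝ) < k := lt_of_lt_of_le (by positivity) hk
  have hcard : (S.offDiag.card : ℝ) * (2 * Real.exp (-(k * lam ^ 2 / 8))) < 1 := by
    refine lt_of_le_of_lt ?_ (card_mul_exp_lt_one hn)
    rw [Finset.offDiag_card, hS]
    rw [div_le_iff₀ (by positivity)] at hk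
    gcongr
    linarith
  obtain ⟨R, hR⟩ := exists_forall_sum_inner_sq S.offDiag
    (fun p => (‖p.1 - p.2‖⁻¹ : ℝ) • (p.1 - p.2))
    (fun p hp => norm_smul_inv_norm (𝕜 := ℝ) (sub_ne_zero.2 (Finset.mem_offDiag.1 hp).2.2))
    hlam hlam1 hcard
  refine ⟨projection R, fun x hx y hy => ?_⟩
  rcases eq_or_ne x y with rfl | hxy
  · simp
  have hnorm : 0 < ‖x - y‖ := norm_pos_iff.2 (sub_ne_zero.2 hxy)
  obtain ⟨hlow, hup⟩ := hR (x, y) (Finset.mem_offDiag.2 ⟨hx, hy, hxy⟩)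
  simp only [real_inner_smul_left, mul_pow, ← Finset.mul_sum, inv_pow] at hlow hup
  rw [← div_eq_inv_mul, le_div_iff₀ (by positivity)] at hlow
  rw [← div_eq_inv_mul, div_le_iff₀ (by positivity)] at hup
  rw [← map_sub, norm_projection_sq, le_div_iff₀ hk0, div_le_iff₀ hk0]
  constructor <;> linarith
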